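/- Let S : ℝⁿ ⇉ ℝⁿ and (x̄, ȳ) ∈ gph S. Then S is locally maximal monotone around (x̄, ȳ) if and only if there exist a maximally monotone mapping S̄ : ℝⁿ ⇉ ℝⁿ and a neighborhood U × V of (x̄, ȳ) such that gph S ∩ (U × V) = gph S̄ ∩ (U × V). -/

import Mathlib

open scoped RealInnerProductSpace
open Filter Topology Metric

noncomputable section

abbrev En (n : ℕ) := EuclideanSpace ℝ (Fin n)

variable {n : ℕ}

/-- The graph of a set-valued mapping. -/
def Gph (S : En n → Set (En n)) : Set (En n × En n) := {p | p.2 ∈ S p.1}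

/-- S is monotone relative to W. -/
def MonoRel (S : En n → Set (En n)) (W : Set (En n × En n)) : Prop :=
  ∀ p ∈ Gph S ∩ W, ∀ q ∈ Gph S ∩ W, 0 ≤ ⟪p.2 - q.2, p.1 - q.1⟫

/-- S is (globally) monotone. -/
def Mono (S : En n → Set (En n)) : Prop := MonoRel S Set.univ

/-- S is maximally monotone. -/
def MaxMono (S : En n → Set (En n)) : Prop :=
  Mono S ∧ ∀ S' : En n → Set (En n), Mono S' → Gph S ⊆ Gph S' → Gph S' = Gph S

/-- S is locally maximal monotone around (x̄, ȳ). -/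
def LocMaxMono (S : En n → Set (En n)) (xb yb : En n) : Prop :=
  ∃ U V : Set (En n), U ∈ 𝓝 xb ∧ V ∈ 𝓝 yb ∧ MonoRel S (U ×ˢ V) ∧
    ∀ S' : En n → Set (En n), Mono S' → Gph S ∩ U ×ˢ V ⊆ Gph S' →
      Gph S ∩ U ×ˢ V = Gph S' ∩ U ×ˢ V

section Resolvent

variable {E : Type*} [NormedAddCommGroup E] [InnerProductSpace ℝ E]

/-- A set of pairs is monotone when any two of its elements are monotonically related. -/
def MonotonePairs (M : Set (E × E)) : Prop :=
  ∀ p ∈ M, ∀ q ∈ M, 0 ≤ ⟪p.2 - q.2, p.1 - q.1⟫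

/-- The lift of a pair `(a, b)` to `(a, b, ⟪a, b⟫)`. -/
def pairLift (p : E × E) : E × E × ℝ := (p.1, p.2, ⟪p.1, p.2⟫)

/-- On the convex hull of the lift of a monotone set, the last coordinate dominates the pairing
of the first two. -/
lemma MonotonePairs.inner_le_of_mem_convexHull {M : Set (E × E)} (hM : MonotonePairs M)
    {y : E × E × ℝ} (hy : y ∈ convexHull ℝ (pairLift '' M)) : ⟪y.1, y.2.1⟫ ≤ y.2.2 := by
  have halfspace (z : E × E × ℝ) :
      Convex ℝ {w : E × E × ℝ | 0 ≤ z.2.2 + w.2.2 - ⟪z.1, w.2.1⟫ - ⟪w.1, z.2.1⟫} := by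
    intro w hw w' hw' s t hs ht hst
    simp only [Set.mem_ofPred_eq, Prod.fst_add, Prod.snd_add, Prod.smul_fst, Prod.smul_snd,
      inner_add_left, inner_add_right, real_inner_smul_left, real_inner_smul_right,
      smul_eq_mul] at hw hw' ⊢
    obtain rfl : t = 1 - s := by linarith
    nlinarith [mul_nonneg hs hw, mul_nonneg ht hw']
  have left_lift : ∀ p ∈ M, ∀ w ∈ convexHull ℝ (pairLift '' M),
      0 ≤ (pairLift p).2.2 + w.2.2 - ⟪(pairLift p).1, w.2.1⟫ - ⟪w.1, (pairLift p).2.1⟫ := by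
    intro p hp w hw
    refine convexHull_min ?_ (halfspace (pairLift p)) hw
    rintro _ ⟨q, hq, rfl⟩
    have := hM p hp q hq
    simp only [pairLift, Set.mem_ofPred_eq, inner_sub_left, inner_sub_right] at this ⊢
    linarith [real_inner_comm p.1 p.2, real_inner_comm q.1 q.2, real_inner_comm p.1 q.2,
      real_inner_comm q.1 p.2]
  have hyy : 0 ≤ y.2.2 + y.2.2 - ⟪y.1, y.2.1⟫ - ⟪y.1, y.2.1⟫ := by
    refine convexHull_min ?_ (halfspace y) hy
    rintro _ ⟨p, hp, rfl⟩
    have := left_lift p hp y hy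
    simp only [Set.mem_ofPred_eq]
    linarith
  linarith

lemma inner_sub_add_eq (a b u : E) :
    ⟪a - u, b + u⟫ = ⟪a, b⟫ + ⟪a, u⟫ - ⟪u, b⟫ - ‖u‖ ^ 2 := by
  rw [inner_sub_left, inner_add_right, inner_add_right, real_inner_self_eq_norm_sq]
  ring

lemma MonotonePairs.exists_forall_inner_nonneg_of_finite {M : Set (E × E)}
    (hM : MonotonePairs M) (hfin : M.Finite) (hne : M.Nonempty) :
    ∃ u : E, ∀ p ∈ M, 0 ≤ ⟪p.1 - u, p.2 + u⟫ := by
  by_contra! hcon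
  let X : Set E := convexHull ℝ (Prod.fst '' M)
  let Y : Set (E × E × ℝ) := convexHull ℝ (pairLift '' M)
  let f : E → E × E × ℝ → ℝ := fun u y => ‖u‖ ^ 2 + ⟪u, y.2.1⟫ - ⟪y.1, u⟫ - y.2.2
  have hX : Convex ℝ X := convex_convexHull ℝ _
  have hY : Convex ℝ Y := convex_convexHull ℝ _
  obtain ⟨y, hy, hfy⟩ : ∃ y ∈ Y, ∀ u ∈ X, 0 < f u y := by
    refine Sion.exists_lt_iInf_of_lt_iInf_of_finite (X := X) (Y := Y) (f := f)
      (s := pairLift '' M) ?_ ?_ ?_ ?_ hY ?_ ?_ hX (hfin.image _) (subset_convexHull ℝ _) ?_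
    · exact (hne.image _).mono (subset_convexHull ℝ _)
    · exact (hfin.image _).isCompact_convexHull (𝕜 := ℝ)
    · intro y _
      have : Continuous fun u => f u y := by fun_prop
      exact this.lowerSemicontinuous.lowerSemicontinuousOn _
    · intro y _
      have hsq : ConvexOn ℝ X fun u : E => ‖u‖ ^ 2 :=
        (convexOn_norm hX).pow (fun _ _ => norm_nonneg _) 2
      refine ConvexOn.quasiconvexOn ⟨hX, fun u hu w hw s t hs ht hst => ?_⟩
      have := hsq.2 hu hw hs ht hst
      simp only [f, inner_add_left, inner_add_right, real_inner_smul_left,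
        real_inner_smul_right, smul_eq_mul] at this ⊢
      obtain rfl : t = 1 - s := by linarith
      linarith
    · intro u _
      have : Continuous fun y => f u y := by fun_prop
      exact this.upperSemicontinuous.upperSemicontinuousOn _
    · intro u _
      refine ConcaveOn.quasiconcaveOn ⟨hY, fun y _ w _ s t hs ht hst => le_of_eq ?_⟩
      simp only [f, Prod.fst_add, Prod.snd_add, Prod.smul_fst, Prod.smul_snd,
        inner_add_left, inner_add_right, real_inner_smul_left,
        real_inner_smul_right, smul_eq_mul]
      obtain rfl : t = 1 - s := by linarith
      ring
    · intro u _
      obtain ⟨p, hp, hlt⟩ := hcon u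
      refine ⟨_, ⟨p, hp, rfl⟩, ?_⟩
      rw [inner_sub_add_eq] at hlt
      simp only [f, pairLift]
      linarith
  have hyX : y.1 ∈ X := by
    have himage : (LinearMap.fst ℝ E (E × ℝ)) '' Y = X := by
      rw [LinearMap.image_convexHull, Set.image_image]
      rfl
    exact himage ▸ ⟨y, hy, rfl⟩
  have hpos := hfy y.1 hyX
  simp only [f, real_inner_self_eq_norm_sq] at hpos
  linarith [hM.inner_le_of_mem_convexHull hy]

lemma MonotonePairs.exists_forall_inner_nonneg [ProperSpace E] {M : Set (E × E)}
    (hM : MonotonePairs M) : ∃ u : E, ∀ p ∈ M, 0 ≤ ⟪p.1 - u, p.2 + u⟫ := by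
  obtain rfl | ⟨p₀, hp₀⟩ := M.eq_empty_or_nonempty
  · simp
  let C : E × E → Set E := fun p => {u | 0 ≤ ⟪p.1 - u, p.2 + u⟫}
  have hclosed (p : E × E) : IsClosed (C p) := isClosed_le (by fun_prop) (by fun_prop)
  have hcompact : IsCompact (C p₀) := by
    refine (isCompact_closedBall (0 : E)
      (2 * (‖p₀.1‖ + ‖p₀.2‖))).of_isClosed_subset (hclosed p₀) fun u hu => ?_
    simp only [C, Set.mem_ofPred_eq, inner_sub_add_eq] at hu
    rw [mem_closedBall_zero_iff]
    have h₁ := real_inner_le_norm p₀.1 p₀.2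
    have h₂ := real_inner_le_norm p₀.1 u
    have h₃ := neg_le_of_abs_le (abs_real_inner_le_norm u p₀.2)
    by_contra! hlt
    have h₁₂ := mul_nonneg (norm_nonneg p₀.1) (norm_nonneg p₀.2)
    nlinarith [norm_nonneg p₀.1, norm_nonneg p₀.2, norm_nonneg u]
  obtain ⟨u, -, hu⟩ := hcompact.inter_iInter_nonempty (fun p : M => C p) (fun p => hclosed p) (by
    intro s
    have hsub : insert p₀ (Subtype.val '' (s : Set M)) ⊆ M := by
      rintro q (rfl | ⟨q, -, rfl⟩)
      exacts [hp₀, q.2]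
    obtain ⟨u, hu⟩ := MonotonePairs.exists_forall_inner_nonneg_of_finite
      (M := insert p₀ (Subtype.val '' (s : Set M)))
      (fun p hp q hq => hM p (hsub hp) q (hsub hq))
      ((s.finite_toSet.image _).insert _) (Set.insert_nonempty _ _)
    refine ⟨u, hu _ (Set.mem_insert _ _), Set.mem_iInter₂.2 fun p hp => hu _ ?_⟩
    exact Set.mem_insert_of_mem _ ⟨p, hp, rfl⟩)
  exact ⟨u, fun p hp => Set.mem_iInter.1 hu ⟨p, hp⟩⟩

end Resolvent

section Penalty

variable {E : Type*} [NormedAddCommGroup E]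

/-- The factor `1 - r / max r ‖u‖`, for which `shrinkFactor r u • u` is the difference between `u`
and its projection onto the closed ball of radius `r` around the origin. -/
def shrinkFactor (r : ℝ) (u : E) : ℝ := 1 - r / max r ‖u‖

lemma shrinkFactor_nonneg {r : ℝ} (hr : 0 < r) (u : E) : 0 ≤ shrinkFactor r u := by
  have : r / max r ‖u‖ ≤ 1 := div_le_one_of_le₀ (le_max_left _ _) (hr.le.trans (le_max_left _ _))
  rw [shrinkFactor]
  linarith

lemma shrinkFactor_of_le {r : ℝ} (hr : 0 < r) {u : E} (hu : ‖u‖ ≤ r) : shrinkFactor r u = 0 := by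
  rw [shrinkFactor, max_eq_left hu, div_self hr.ne', sub_self]

lemma shrinkFactor_mul_norm {r : ℝ} (hr : 0 < r) {u : E} (hu : r ≤ ‖u‖) :
    shrinkFactor r u * ‖u‖ = ‖u‖ - r := by
  have : ‖u‖ ≠ 0 := (hr.trans_le hu).ne'
  rw [shrinkFactor, max_eq_right hu]
  field_simp

variable [InnerProductSpace ℝ E]

lemma norm_sub_shrinkFactor_smul_le {r : ℝ} (hr : 0 < r) (u : E) :
    ‖u - shrinkFactor r u • u‖ ≤ r := by
  obtain hu | hu := le_total ‖u‖ r
  · simpa [shrinkFactor_of_le hr hu] using hu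
  · have hpos : 0 ≤ r / ‖u‖ := by positivity
    have hne : ‖u‖ ≠ 0 := (hr.trans_le hu).ne'
    have : u - shrinkFactor r u • u = (r / ‖u‖) • u := by
      rw [shrinkFactor, max_eq_right hu, sub_smul, one_smul, sub_sub_cancel]
    rw [this, norm_smul, Real.norm_of_nonneg hpos, div_mul_cancel₀ _ hne]

lemma inner_shrinkFactor_smul_le {r : ℝ} (hr : 0 < r) (u : E) {c : E} (hc : ‖c‖ ≤ r) :
    ⟪shrinkFactor r u • u, c - (u - shrinkFactor r u • u)⟫ ≤ 0 := by
  obtain hu | hu := le_total ‖u‖ r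
  · simp [shrinkFactor_of_le hr hu]
  · have hg := shrinkFactor_nonneg hr u
    have hgu := shrinkFactor_mul_norm hr hu
    have hcs := real_inner_le_norm u c
    rw [real_inner_smul_left, inner_sub_right, inner_sub_right, real_inner_smul_right,
      real_inner_self_eq_norm_sq]
    refine mul_nonpos_of_nonneg_of_nonpos hg ?_
    have : shrinkFactor r u * ‖u‖ ^ 2 = (‖u‖ - r) * ‖u‖ := by rw [← hgu]; ring
    nlinarith [norm_nonneg u]

/-- The map `u ↦ shrinkFactor r u • u` is firmly nonexpansive. -/
lemma norm_sq_shrinkFactor_smul_sub_le {r : ℝ} (hr : 0 < r) (u w : E) :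
    ‖shrinkFactor r u • u - shrinkFactor r w • w‖ ^ 2 ≤
      ⟪shrinkFactor r u • u - shrinkFactor r w • w, u - w⟫ := by
  have h₁ := inner_shrinkFactor_smul_le hr u (norm_sub_shrinkFactor_smul_le hr w)
  have h₂ := inner_shrinkFactor_smul_le hr w (norm_sub_shrinkFactor_smul_le hr u)
  rw [← real_inner_self_eq_norm_sq]
  generalize shrinkFactor r u • u = a at *
  generalize shrinkFactor r w • w = b at *
  simp only [inner_sub_left, inner_sub_right] at *
  linarith

lemma norm_shrinkFactor_smul_sub_le {r : ℝ} (hr : 0 < r) (u w : E) :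
    ‖shrinkFactor r u • u - shrinkFactor r w • w‖ ≤ ‖u - w‖ := by
  have h₁ := norm_sq_shrinkFactor_smul_sub_le hr u w
  have h₂ := real_inner_le_norm (shrinkFactor r u • u - shrinkFactor r w • w) (u - w)
  by_contra! hlt
  nlinarith [norm_nonneg (u - w)]

end Penalty

lemma MaxMono.mem_of_forall {T : En n → Set (En n)} (hT : MaxMono T) {p : En n × En n}
    (hp : ∀ q ∈ Gph T, 0 ≤ ⟪p.2 - q.2, p.1 - q.1⟫) : p ∈ Gph T := by
  let T' : En n → Set (En n) := fun x => {y | (x, y) ∈ insert p (Gph T)}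
  have hT' : Gph T' = insert p (Gph T) := rfl
  have hmono : Mono T' := by
    rintro a ⟨ha, -⟩ b ⟨hb, -⟩
    rw [hT'] at ha hb
    obtain rfl | ha := ha <;> obtain rfl | hb := hb
    · simp
    · exact hp b hb
    · have := hp a ha
      rwa [← inner_neg_neg, neg_sub, neg_sub] at this
    · exact hT.1 a ⟨ha, trivial⟩ b ⟨hb, trivial⟩
  rw [← hT.2 T' hmono (hT' ▸ Set.subset_insert _ _), hT']
  exact Set.mem_insert _ _

lemma MaxMono.inner_nonneg {T : En n → Set (En n)} (hT : MaxMono T) {p q : En n × En n}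
    (hp : p ∈ Gph T) (hq : q ∈ Gph T) : 0 ≤ ⟪p.2 - q.2, p.1 - q.1⟫ :=
  hT.1 p ⟨hp, trivial⟩ q ⟨hq, trivial⟩

/-- Minty's theorem: `I + c T` is surjective for a maximally monotone `T` and `c > 0`. -/
lemma MaxMono.exists_add_smul_eq {T : En n → Set (En n)} (hT : MaxMono T) {c : ℝ} (hc : 0 < c)
    (z : En n) : ∃ p ∈ Gph T, p.1 + c • p.2 = z := by
  let φ : En n × En n → En n × En n := fun p => (p.1, c • p.2 - z)
  have hM : MonotonePairs (φ '' Gph T) := by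
    rintro _ ⟨p, hp, rfl⟩ _ ⟨q, hq, rfl⟩
    simp only [φ, sub_sub_sub_cancel_right, ← smul_sub, real_inner_smul_left]
    exact mul_nonneg hc.le (hT.inner_nonneg hp hq)
  obtain ⟨u, hu⟩ := hM.exists_forall_inner_nonneg
  refine ⟨(u, c⁻¹ • (z - u)), hT.mem_of_forall fun q hq => ?_, by simp [smul_smul, hc.ne']⟩
  have h := hu _ ⟨q, hq, rfl⟩
  have heq : ⟪c⁻¹ • (z - u) - q.2, u - q.1⟫ = c⁻¹ * ⟪q.1 - u, c • q.2 - z + u⟫ := by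
    rw [← real_inner_smul_right, real_inner_comm, ← inner_neg_neg, neg_sub]
    congr 1
    simp only [smul_add, smul_sub, smul_smul, inv_mul_cancel₀ hc.ne', one_smul]
    abel
  simp only [heq]
  exact mul_nonneg (inv_nonneg.2 hc.le) h

/-- A maximally monotone mapping plus a Lipschitz strongly monotone map has a zero. -/
lemma MaxMono.exists_add_eq_zero {T : En n → Set (En n)} (hT : MaxMono T) {F : En n → En n}
    {d L : ℝ} (hd : 0 < d) (hdL : d < L)
    (hmono : ∀ u w, d * ‖u - w‖ ^ 2 ≤ ⟪F u - F w, u - w⟫)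
    (hlip : ∀ u w, ‖F u - F w‖ ≤ L * ‖u - w‖) : ∃ p ∈ Gph T, p.2 + F p.1 = 0 := by
  have hL : 0 < L := hd.trans hdL
  let c := d / L ^ 2
  have hc : 0 < c := by positivity
  choose R hR hRz using fun z => hT.exists_add_smul_eq hc z
  have hq : d ^ 2 / L ^ 2 < 1 := by
    rw [div_lt_one (by positivity)]
    exact pow_lt_pow_left₀ hdL hd.le two_ne_zero
  have hR_le (z z' : En n) : ‖(R z).1 - (R z').1‖ ^ 2 ≤ ‖z - z'‖ ^ 2 := by
    have h := hT.inner_nonneg (hR z) (hR z')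
    have hz : z - z' = ((R z).1 - (R z').1) + c • ((R z).2 - (R z').2) := by
      nth_rewrite 1 [← hRz z, ← hRz z']
      rw [smul_sub]
      abel
    rw [hz, norm_add_sq_real, real_inner_smul_right, real_inner_comm]
    have := mul_nonneg hc.le h
    nlinarith [sq_nonneg ‖c • ((R z).2 - (R z').2)‖]
  let K : NNReal := ⟨√(1 - d ^ 2 / L ^ 2), Real.sqrt_nonneg _⟩
  have hK : ContractingWith K fun u => (R (u - c • F u)).1 := by
    refine ⟨?_, LipschitzWith.of_dist_le_mul fun u w => ?_⟩
    · rw [← NNReal.coe_lt_coe]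
      refine (Real.sqrt_lt' one_pos).2 ?_
      have : 0 < d ^ 2 / L ^ 2 := by positivity
      linarith
    · rw [dist_eq_norm, dist_eq_norm]
      refine abs_le_of_sq_le_sq' ?_ (by positivity) |>.2
      refine (hR_le _ _).trans ?_
      have hz : u - c • F u - (w - c • F w) = (u - w) - c • (F u - F w) := by
        rw [smul_sub]
        abel
      have hKsq : (K : ℝ) ^ 2 = 1 - d ^ 2 / L ^ 2 := Real.sq_sqrt (by linarith)
      rw [hz, norm_sub_sq_real, real_inner_smul_right, real_inner_comm, norm_smul,
        Real.norm_of_nonneg hc.le, mul_pow, mul_pow, hKsq]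
      have h₁ := mul_le_mul_of_nonneg_left (hmono u w) hc.le
      have h₂ := pow_le_pow_left₀ (norm_nonneg _) (hlip u w) 2
      have h₃ := mul_le_mul_of_nonneg_left h₂ (sq_nonneg c)
      have e₁ : c * (d * ‖u - w‖ ^ 2) = d ^ 2 / L ^ 2 * ‖u - w‖ ^ 2 := by
        simp only [c]
        ring
      have e₂ : c ^ 2 * (L * ‖u - w‖) ^ 2 = d ^ 2 / L ^ 2 * ‖u - w‖ ^ 2 := by
        simp only [c]
        field_simp
      linarith
  have hfix : (R (_ - c • F _)).1 = _ := hK.fixedPoint_isFixedPt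
  set u := ContractingWith.fixedPoint (fun u => (R (u - c • F u)).1) hK
  refine ⟨_, hR (u - c • F u), ?_⟩
  have h := hRz (u - c • F u)
  rw [hfix] at h ⊢
  have h' : c • ((R (u - c • F u)).2 + F u) = 0 := by
    rw [smul_add]
    have := congrArg (fun t => t - u + c • F u) h
    simpa using this
  exact (smul_eq_zero.1 h').resolve_left hc.ne'

/-- A maximally monotone mapping is maximal inside products of balls of equal radius centered at
a point of its graph. -/
lemma MaxMono.mem_of_forall_mem_ball {T : En n → Set (En n)} (hT : MaxMono T) {xb yb x y : En n}
    (hb : (xb, yb) ∈ Gph T) {ε : ℝ} (hx : x ∈ ball xb ε) (hy : y ∈ ball yb ε)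
    (hrel : ∀ q ∈ Gph T ∩ ball xb ε ×ˢ ball yb ε, 0 ≤ ⟪y - q.2, x - q.1⟫) :
    (x, y) ∈ Gph T := by
  rw [mem_ball_iff_norm] at hx hy
  have hε : 0 < ε := (norm_nonneg _).trans_lt hx
  obtain ⟨r, hxr, hrε⟩ := exists_between hx
  have hr : 0 < r := (norm_nonneg _).trans_lt hxr
  obtain ⟨d, hd, hdε⟩ : ∃ d : ℝ, 0 < d ∧ ‖y - yb‖ + d * (2 * ε) < ε := by
    refine ⟨(ε - ‖y - yb‖) / (4 * ε), div_pos (by linarith) (by linarith), ?_⟩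
    have : (ε - ‖y - yb‖) / (4 * ε) * (2 * ε) = (ε - ‖y - yb‖) / 2 := by
      field_simp
      ring
    linarith
  obtain ⟨m, hm, hmε⟩ : ∃ m : ℝ, 0 < m ∧ ε < m * (ε - r) := by
    refine ⟨2 * ε / (ε - r), div_pos (by linarith) (by linarith), ?_⟩
    rw [div_mul_cancel₀ _ (by linarith)]
    linarith
  let G : En n → En n := fun u => shrinkFactor r (u - xb) • (u - xb)
  have hG (u w : En n) : ‖G u - G w‖ ^ 2 ≤ ⟪G u - G w, u - w⟫ := by
    simpa using norm_sq_shrinkFactor_smul_sub_le hr (u - xb) (w - xb)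
  have hGx : G x = 0 := by simp [G, shrinkFactor_of_le hr hxr.le]
  let F : En n → En n := fun u => d • (u - x) + m • G u - y
  have hF (u w : En n) : F u - F w = d • (u - w) + m • (G u - G w) := by
    simp only [F, smul_sub]
    abel
  obtain ⟨⟨u, v⟩, huv, hzero⟩ : ∃ p ∈ Gph T, p.2 + F p.1 = 0 := by
    refine hT.exists_add_eq_zero (F := F) hd (lt_add_of_pos_right d hm) (fun u w => ?_)
      fun u w => ?_
    · rw [hF, inner_add_left, real_inner_smul_left, real_inner_smul_left,
        real_inner_self_eq_norm_sq]
      nlinarith [hG u w, sq_nonneg ‖G u - G w‖]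
    · have h : ‖G u - G w‖ ≤ ‖u - w‖ := by
        simpa using norm_shrinkFactor_smul_sub_le hr (u - xb) (w - xb)
      calc ‖F u - F w‖ ≤ ‖d • (u - w)‖ + ‖m • (G u - G w)‖ := hF u w ▸ norm_add_le _ _
        _ = d * ‖u - w‖ + m * ‖G u - G w‖ := by
          rw [norm_smul, norm_smul, Real.norm_of_nonneg hd.le, Real.norm_of_nonneg hm.le]
        _ ≤ (d + m) * ‖u - w‖ := by nlinarith
  have hv : y - v = d • (u - x) + m • G u := by
    simp only [F] at hzero
    rw [← sub_eq_zero, ← neg_eq_zero, ← hzero]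
    abel
  have hg := shrinkFactor_nonneg hr (u - xb)
  have hbuv : 0 ≤ ⟪v - yb, u - xb⟫ := hT.inner_nonneg huv hb
  have hu : ‖u - xb‖ < ε := by
    by_contra! hlt
    have hGu := shrinkFactor_mul_norm hr (hrε.le.trans hlt)
    have hvb : v - yb = (y - yb) - d • ((u - xb) - (x - xb)) -
        (m * shrinkFactor r (u - xb)) • (u - xb) := by
      rw [mul_smul, sub_sub_sub_cancel_right, sub_sub, ← hv]
      abel
    rw [hvb, inner_sub_left, inner_sub_left, real_inner_smul_left, real_inner_smul_left,
      inner_sub_left (u - xb), real_inner_self_eq_norm_sq] at hbuv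
    have h₁ := real_inner_le_norm (y - yb) (u - xb)
    have h₂ := real_inner_le_norm (x - xb) (u - xb)
    have h₃ : m * shrinkFactor r (u - xb) * ‖u - xb‖ ^ 2 =
        m * (‖u - xb‖ - r) * ‖u - xb‖ := by
      rw [← hGu]
      ring
    have h₄ : 0 ≤ d * (‖u - xb‖ ^ 2 - ⟪x - xb, u - xb⟫) :=
      mul_nonneg hd.le (by nlinarith [norm_nonneg (x - xb)])
    have h₅ : ε < m * (‖u - xb‖ - r) := hmε.trans_le (by gcongr)
    nlinarith [norm_nonneg (y - yb)]
  have hvε : ‖v - yb‖ < ε := by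
    have hsplit : (y - yb) - d • (u - x) =
        (v - yb) + (m * shrinkFactor r (u - xb)) • (u - xb) := by
      rw [mul_smul, ← sub_eq_iff_eq_add', ← sub_eq_zero, ← sub_eq_zero.2 hv]
      simp only [G]
      abel
    have hle : ‖v - yb‖ ≤ ‖(y - yb) - d • (u - x)‖ := by
      refine abs_le_of_sq_le_sq' ?_ (norm_nonneg _) |>.2
      rw [hsplit, norm_add_sq_real, real_inner_smul_right]
      have := mul_nonneg (mul_nonneg hm.le hg) hbuv
      nlinarith [sq_nonneg ‖(m * shrinkFactor r (u - xb)) • (u - xb)‖]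
    have hux : ‖u - x‖ ≤ 2 * ε := by
      have := norm_sub_le (u - xb) (x - xb)
      rw [sub_sub_sub_cancel_right] at this
      linarith
    have h := norm_sub_le (y - yb) (d • (u - x))
    rw [norm_smul, Real.norm_of_nonneg hd.le] at h
    have := mul_le_mul_of_nonneg_left hux hd.le
    linarith
  have hq := hrel (u, v) ⟨huv, mem_ball_iff_norm.2 hu, mem_ball_iff_norm.2 hvε⟩
  have hGux := hG u x
  rw [hGx, sub_zero] at hGux
  have hux : u = x := by
    simp only at hq
    rw [hv, ← neg_sub u x, inner_neg_right, inner_add_left, real_inner_smul_left,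
      real_inner_smul_left, real_inner_self_eq_norm_sq] at hq
    have := mul_nonneg hm.le ((sq_nonneg _).trans hGux)
    have hsq : ‖u - x‖ ^ 2 = 0 := by nlinarith [sq_nonneg ‖u - x‖]
    exact sub_eq_zero.1 (norm_eq_zero.1 (pow_eq_zero_iff two_ne_zero |>.1 hsq))
  subst hux
  rw [hGx, sub_self, smul_zero, smul_zero, add_zero, sub_eq_zero] at hv
  exact hv ▸ huv

/-- Every monotone set of pairs is contained in the graph of a maximally monotone mapping. -/
lemma MonotonePairs.exists_maxMono {M : Set (En n × En n)} (hM : MonotonePairs M) :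
    ∃ T : En n → Set (En n), MaxMono T ∧ M ⊆ Gph T := by
  obtain ⟨N, hMN, hN⟩ := zorn_subset_nonempty {N : Set (En n × En n) | MonotonePairs N}
    (fun c hc hchain _ => ⟨⋃₀ c, by
      rintro p ⟨A, hA, hp⟩ q ⟨B, hB, hq⟩
      obtain hAB | hBA := hchain.total hA hB
      · exact hc hB p (hAB hp) q hq
      · exact hc hA p hp q (hBA hq), fun _ => Set.subset_sUnion_of_mem⟩) M hM
  refine ⟨fun x => {y | (x, y) ∈ N}, ⟨fun p hp q hq => hN.1 p hp.1 q hq.1, ?_⟩, hMN⟩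
  intro T' hT' hsub
  exact (hN.2 (fun p hp q hq => hT' p ⟨hp, trivial⟩ q ⟨hq, trivial⟩) hsub).antisymm hsub

theorem stmt10 (S : En n → Set (En n)) (xb yb : En n) (h : (xb, yb) ∈ Gph S) :
    LocMaxMono S xb yb ↔
      ∃ (Sb : En n → Set (En n)) (U V : Set (En n)), MaxMono Sb ∧
        U ∈ 𝓝 xb ∧ V ∈ 𝓝 yb ∧ Gph S ∩ U ×ˢ V = Gph Sb ∩ U ×ˢ V := by
  constructor
  · rintro ⟨U, V, hU, hV, hmono, hmax⟩
    obtain ⟨T, hT, hsub⟩ := MonotonePairs.exists_maxMono (M := Gph S ∩ U ×ˢ V) hmono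
    exact ⟨T, U, V, hT, hU, hV, hmax T hT.1 hsub⟩
  · rintro ⟨T, U, V, hT, hU, hV, heq⟩
    obtain ⟨ε, hε, hεUV⟩ : ∃ ε > 0, ball xb ε ×ˢ ball yb ε ⊆ U ×ˢ V := by
      obtain ⟨ε₁, hε₁, hεU⟩ := Metric.mem_nhds_iff.1 hU
      obtain ⟨ε₂, hε₂, hεV⟩ := Metric.mem_nhds_iff.1 hV
      exact ⟨min ε₁ ε₂, lt_min hε₁ hε₂, Set.prod_mono
        ((ball_subset_ball (min_le_left _ _)).trans hεU)
        ((ball_subset_ball (min_le_right _ _)).trans hεV)⟩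
    have hiff : ∀ p ∈ ball xb ε ×ˢ ball yb ε, p ∈ Gph S ↔ p ∈ Gph T := fun p hp => by
      have := Set.ext_iff.1 heq p
      simpa [Set.mem_inter_iff, hεUV hp] using this
    refine ⟨ball xb ε, ball yb ε, ball_mem_nhds _ hε, ball_mem_nhds _ hε, ?_, ?_⟩
    · rintro p ⟨hp, hpb⟩ q ⟨hq, hqb⟩
      exact hT.inner_nonneg ((hiff p hpb).1 hp) ((hiff q hqb).1 hq)
    · intro S' hS' hsub
      refine Set.Subset.antisymm (fun p hp => ⟨hsub hp, hp.2⟩) fun p hp => ⟨?_, hp.2⟩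
      have hbT := (hiff (xb, yb) ⟨mem_ball_self hε, mem_ball_self hε⟩).1 h
      refine (hiff p hp.2).2 (hT.mem_of_forall_mem_ball hbT hp.2.1 hp.2.2 fun q hq => ?_)
      exact hS' p ⟨hp.1, trivial⟩ q ⟨hsub ⟨(hiff q hq.2).2 hq.1, hq.2⟩, trivial⟩
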